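/- For every rate R = k/n ∈ (0,1), every α with 0 < α < 1/2 and H(α) < 1 − R, and every θ > log₂(1/(2^{1−R} − 1)), there exists a constant d₀ (depending only on n, R, α, θ, and not on T) such that for every horizon T > 0 there exists a causal linear code H ∈ F₂^{n̄T×nT} of horizon T having (α,θ,d₀)-anytime distance. -/

import Mathlib

/-!
STATEMENT 0: For every rate `R = k/n ∈ (0,1)`, every `α` with `0 < α < 1/2` and
`H(α) < 1 − R`, and every `θ > log₂(1/(2^{1−R} − 1))`, there is a constant `d₀`
(independent of the horizon `T`) such that for every `T > 0` there exists a causal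
linear code of horizon `T` — a block lower-triangular, full-row-rank matrix
`H ∈ F₂^{n̄T×nT}` — with `(α,θ,d₀)`-anytime distance: for all `t ≤ T` and all
`d₀ ≤ d ≤ t`, `minW(d,t) ≥ αnd` and `numW(w,d,t) ≤ 2^{θw}` for all `w ≥ αnd`.
-/

open scoped BigOperators

/-- Binary entropy function in bits (with `H(0) = H(1) = 0`, since `Real.logb 2 0 = 0`). -/
noncomputable def binH (x : ℝ) : ℝ := -(x * Real.logb 2 x) - (1 - x) * Real.logb 2 (1 - x)

/-- A block vector `(c₁, …, c_t) ∈ (F₂ⁿ)^t` flattened into a vector indexed by `Fin t × Fin n`. -/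
def flat {t n : ℕ} (c : Fin t → Fin n → ZMod 2) : Fin t × Fin n → ZMod 2 :=
  fun q => c q.1 q.2

/-- Hamming weight `‖c‖` of a block vector. -/
def wt {t n : ℕ} (c : Fin t → Fin n → ZMod 2) : ℕ := hammingNorm (flat c)

/-- `C_{t,d}` for a horizon-`T` causal code `H`: block vectors `c = (c₁,…,c_t)` with
`Hᵗ c = 0` (where `Hᵗ` is the leading principal `n̄t × nt` submatrix of `H`),
`c_τ = 0` for `τ < t−d+1`, and `c_{t−d+1} ≠ 0` (blocks are indexed from `0` here, so
`c ⟨t−d⟩` is the `(t−d+1)`-st block). -/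
def CsetT (nb n T : ℕ) (H : Matrix (Fin T × Fin nb) (Fin T × Fin n) (ZMod 2))
    (t : ℕ) (ht : t ≤ T) (d : ℕ) :
    Finset (Fin t → Fin n → ZMod 2) :=
  Finset.univ.filter fun c =>
    Matrix.mulVec
        (H.submatrix (fun q : Fin t × Fin nb => (Fin.castLE ht q.1, q.2))
          (fun q : Fin t × Fin n => (Fin.castLE ht q.1, q.2)))
        (flat c) = 0
      ∧ (∀ τ : Fin t, (τ : ℕ) < t - d → c τ = 0)
      ∧ (∀ τ : Fin t, (τ : ℕ) = t - d → c τ ≠ 0)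


namespace AnyT

/-- extension of a finite block sequence by zero -/
def hx {T nb n : ℕ} (h : Fin T → Matrix (Fin nb) (Fin n) (ZMod 2)) (s : ℕ) :
    Matrix (Fin nb) (Fin n) (ZMod 2) := if hs : s < T then h ⟨s, hs⟩ else 0

def toep {T nb n : ℕ} (h : Fin T → Matrix (Fin nb) (Fin n) (ZMod 2)) :
    Matrix (Fin T × Fin nb) (Fin T × Fin n) (ZMod 2) :=
  fun p q => if (q.1 : ℕ) ≤ p.1 then hx h ((p.1 : ℕ) - q.1) p.2 q.2 else 0

def syn {T nb n d : ℕ} (c : Fin d → Fin n → ZMod 2)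
    (h : Fin T → Matrix (Fin nb) (Fin n) (ZMod 2)) (s : Fin d) (a : Fin nb) : ZMod 2 :=
  ∑ j : Fin d, if (j : ℕ) ≤ s then ∑ b, hx h ((s : ℕ) - j) a b * c j b else 0

theorem hx_add {T nb n : ℕ} (h h' : Fin T → Matrix (Fin nb) (Fin n) (ZMod 2)) (s : ℕ) :
    hx (h + h') s = hx h s + hx h' s := by
  unfold hx; split <;> simp

theorem hx_smul {T nb n : ℕ} (r : ZMod 2) (h : Fin T → Matrix (Fin nb) (Fin n) (ZMod 2)) (s : ℕ) :
    hx (r • h) s = r • hx h s := by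
  unfold hx; split <;> simp

def synL {T nb n d : ℕ} (c : Fin d → Fin n → ZMod 2) :
    (Fin T → Matrix (Fin nb) (Fin n) (ZMod 2)) →+ (Fin d → Fin nb → ZMod 2) where
  toFun := syn c
  map_zero' := by
    funext s a
    simp [syn, hx]
  map_add' h h' := by
    funext s a
    simp only [syn, Pi.add_apply]
    rw [← Finset.sum_add_distrib]
    refine Finset.sum_congr rfl fun j _ => ?_
    split
    · rw [← Finset.sum_add_distrib]
      refine Finset.sum_congr rfl fun b _ => ?_
      rw [hx_add, Matrix.add_apply, add_mul]
    · simp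

theorem synL_surj {T nb n d : ℕ} (hdT : d ≤ T) (c : Fin d → Fin n → ZMod 2)
    (hc : ∀ j : Fin d, (j : ℕ) = 0 → c j ≠ 0) :
    Function.Surjective (synL (T := T) (nb := nb) c) := by
  rcases Nat.eq_zero_or_pos d with rfl | hd
  · intro y; exact ⟨0, Subsingleton.elim _ _⟩
  obtain ⟨b0, hb0⟩ := Function.ne_iff.mp (hc ⟨0, hd⟩ rfl)
  let ι : (Fin d → Fin nb → ZMod 2) →+ (Fin T → Matrix (Fin nb) (Fin n) (ZMod 2)) :=
    { toFun := fun v s => Matrix.of fun a b => if hs : (s : ℕ) < d then (if b = b0 then v ⟨s, hs⟩ a else 0) else 0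
      map_zero' := by funext s a b; simp
      map_add' := by
        intro v v'; funext s a b
        simp only [Pi.add_apply, Matrix.add_apply, Matrix.of_apply]
        split_ifs <;> simp }
  have hx_ι : ∀ v (s : ℕ) (hs : s < d) a b, hx (ι v) s a b = if b = b0 then v ⟨s, hs⟩ a else 0 := by
    intro v s hs a b
    have : s < T := by omega
    have e : hx (ι v) s = ι v ⟨s, this⟩ := by unfold hx; rw [dif_pos this]
    rw [e]
    change (if hs : s < d then (if b = b0 then v ⟨s, hs⟩ a else 0) else 0) = _
    rw [dif_pos hs]
  let F := (synL (T := T) (nb := nb) c).comp ι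
  have hinj : Function.Injective F := by
    rw [injective_iff_map_eq_zero]
    intro v hv
    have key : ∀ m : ℕ, ∀ hm : m < d, v ⟨m, hm⟩ = 0 := by
      intro m
      induction m using Nat.strong_induction_on with
      | _ m ih =>
        intro hm
        funext a
        have h1 : syn c (ι v) ⟨m, hm⟩ a = 0 := congrFun (congrFun hv ⟨m, hm⟩) a
        unfold syn at h1
        rw [Finset.sum_eq_single (⟨0, hd⟩ : Fin d)] at h1
        · simp only [Nat.zero_le, if_true, Nat.sub_zero] at h1
          rw [Finset.sum_eq_single b0] at h1
          · rw [hx_ι v m hm] at h1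
            simp only [if_true] at h1
            exact (mul_eq_zero.mp h1).resolve_right hb0
          · intro b _ hb
            rw [hx_ι v m hm, if_neg hb, zero_mul]
          · simp
        · intro j _ hj
          split
          · rename_i hjm
            have hj0 : (j : ℕ) ≠ 0 := fun h => hj (Fin.ext h)
            simp only at hjm
            refine Finset.sum_eq_zero fun b _ => ?_
            simp only
            rw [hx_ι v (m - j) (by omega), ih (m - j) (by omega)]
            simp
          · rfl
        · simp
    funext s
    exact key s s.2
  have hsurj := Finite.surjective_of_injective hinj
  intro y
  obtain ⟨v, hv⟩ := hsurj y
  exact ⟨ι v, hv⟩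

theorem card_ker {T nb n d : ℕ} (hdT : d ≤ T) (c : Fin d → Fin n → ZMod 2)
    (hc : ∀ j : Fin d, (j : ℕ) = 0 → c j ≠ 0) :
    ((Finset.univ.filter fun h : Fin T → Matrix (Fin nb) (Fin n) (ZMod 2) => syn c h = 0).card : ℝ)
      = (Fintype.card (Fin T → Matrix (Fin nb) (Fin n) (ZMod 2)) : ℝ) * (1 / 2 ^ (nb * d)) := by
  have h1 := AddSubgroup.card_eq_card_quotient_mul_card_addSubgroup (synL (T := T) (nb := nb) c).ker
  have h2 := Nat.card_congr (QuotientAddGroup.quotientKerEquivOfSurjective _ (synL_surj (nb := nb) hdT c hc)).toEquiv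
  have h3 : Nat.card (synL (T := T) (nb := nb) c).ker = (Finset.univ.filter fun h : Fin T → Matrix (Fin nb) (Fin n) (ZMod 2) => syn c h = 0).card := by
    rw [← Nat.card_eq_finsetCard]
    refine Nat.card_congr (Equiv.subtypeEquivRight fun h => ?_)
    simp [AddMonoidHom.mem_ker, synL]
  have h4 : Nat.card (Fin d → Fin nb → ZMod 2) = 2 ^ (nb * d) := by
    simp [Nat.card_eq_fintype_card, pow_mul]
  rw [h2, h3, h4, Nat.card_eq_fintype_card] at h1
  rw [h1]
  push_cast
  field_simp

def Dset {T nb n : ℕ} (h : Fin T → Matrix (Fin nb) (Fin n) (ZMod 2)) (d : ℕ) :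
    Finset (Fin d → Fin n → ZMod 2) :=
  Finset.univ.filter fun c => (∀ j : Fin d, (j : ℕ) = 0 → c j ≠ 0) ∧ syn c h = 0

theorem sum_wt (d n : ℕ) (x : ℝ) :
    ∑ c : Fin d → Fin n → ZMod 2, x ^ wt c = (1 + x) ^ (n * d) := by
  have h1 : ∀ c : Fin d → Fin n → ZMod 2, x ^ wt c = ∏ i, ∏ j, if c i j ≠ 0 then x else 1 := by
    intro c
    rw [← Fintype.prod_prod_type' (f := fun i j => if c i j ≠ 0 then x else 1)]
    rw [Finset.prod_ite, Finset.prod_const_one, mul_one, Finset.prod_const]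
    unfold wt hammingNorm flat
    congr!
  have h2 : ∀ r : ZMod 2 → ℝ, ∑ z, r z = r 0 + r 1 := fun r => Fin.sum_univ_two r
  simp_rw [h1]
  have h3 := Fintype.prod_sum (fun (_ : Fin n) (z : ZMod 2) => if z ≠ 0 then x else (1:ℝ))
  have h4 := Fintype.prod_sum (fun (_ : Fin d) (z : Fin n → ZMod 2) => ∏ j, if z j ≠ 0 then x else (1:ℝ))
  rw [← h4]
  simp_rw [← h3, h2]
  simp [pow_mul]

/-- first moment -/
theorem sum_D {T nb n d : ℕ} (hdT : d ≤ T) (f : (Fin d → Fin n → ZMod 2) → ℝ) (hf : ∀ c, 0 ≤ f c) :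
    ∑ h : Fin T → Matrix (Fin nb) (Fin n) (ZMod 2), ∑ c ∈ Dset h d, f c
      ≤ (Fintype.card (Fin T → Matrix (Fin nb) (Fin n) (ZMod 2)) : ℝ) * (1 / 2 ^ (nb * d)) * ∑ c, f c := by
  unfold Dset
  simp_rw [Finset.sum_filter]
  rw [Finset.sum_comm, Finset.mul_sum]
  refine Finset.sum_le_sum fun c _ => ?_
  by_cases hc : ∀ j : Fin d, (j : ℕ) = 0 → c j ≠ 0
  · rw [← card_ker hdT c hc, ← Finset.sum_filter, Finset.sum_const, nsmul_eq_mul]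
    refine le_of_eq ?_
    congr 3
    ext h
    simp only [Finset.mem_filter, Finset.mem_univ, true_and]
    exact ⟨fun h => h.2, fun h => ⟨hc, h⟩⟩
  · simp only [hc, false_and, if_false, Finset.sum_const_zero]
    have := hf c
    positivity

def E (nb n : ℕ) (hn : nb ≤ n) : Matrix (Fin nb) (Fin n) (ZMod 2) :=
  fun a b => if b = Fin.castLE hn a then 1 else 0

theorem toep_indep {T nb n : ℕ} (hn : nb ≤ n) (h : Fin T → Matrix (Fin nb) (Fin n) (ZMod 2))
    (h0 : hx h 0 = E nb n hn) :
    LinearIndependent (ZMod 2) (fun r : Fin T × Fin nb => toep h r) := by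
  rw [Fintype.linearIndependent_iff]
  intro g hg
  have key : ∀ m : ℕ, ∀ i : Fin T, T - (i : ℕ) = m → ∀ a, g (i, a) = 0 := by
    intro m
    induction m using Nat.strong_induction_on with
    | _ m ih =>
      intro i hi a
      have h1 := congrFun hg (i, Fin.castLE hn a)
      rw [Finset.sum_apply, Finset.sum_eq_single (i, a)] at h1
      · simpa [toep, h0, E] using h1
      · rintro ⟨i', a'⟩ _ hne
        simp only [Pi.smul_apply, smul_eq_mul]
        rcases lt_trichotomy (i' : ℕ) i with hlt | heq | hgt
        · have : ¬ (i : ℕ) ≤ i' := by omega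
          simp only [toep, if_neg this, mul_zero]
        · obtain rfl : i' = i := Fin.ext heq
          have : a ≠ a' := by rintro rfl; exact hne rfl
          simp [toep, h0, E, this]
        · rw [ih (T - i') (by omega) i' rfl a', zero_mul]
      · simp
  rintro ⟨i, a⟩
  exact key _ i rfl a

/-- tail of a block vector -/
def tl {t d n : ℕ} (hd : d ≤ t) (c : Fin t → Fin n → ZMod 2) : Fin d → Fin n → ZMod 2 :=
  fun j => c ⟨t - d + j, by omega⟩

theorem sum_tl {M : Type*} [AddCommMonoid M] {t d : ℕ} (hd : d ≤ t) (f : Fin t → M)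
    (hf : ∀ i : Fin t, (i : ℕ) < t - d → f i = 0) :
    ∑ i, f i = ∑ j : Fin d, f ⟨t - d + j, by omega⟩ := by
  symm
  refine Finset.sum_of_injOn (fun j : Fin d => (⟨t - d + j, by omega⟩ : Fin t)) ?_ ?_ ?_ ?_
  · intro a _ b _ hab
    simp only [Fin.mk.injEq] at hab
    exact Fin.ext (by omega)
  · intro a _; simp
  · intro i _ hi
    apply hf
    by_contra hlt
    apply hi
    exact ⟨⟨i - (t - d), by omega⟩, by simp, Fin.ext (by simp; omega)⟩
  · intro i _; rfl

theorem wt_eq {t n : ℕ} (c : Fin t → Fin n → ZMod 2) : wt c = ∑ i, ∑ j, if c i j ≠ 0 then 1 else 0 := by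
  rw [← Fintype.sum_prod_type' (f := fun i j => if c i j ≠ 0 then 1 else 0)]
  unfold wt hammingNorm flat
  rw [Finset.card_filter]

theorem wt_tl {t d n : ℕ} (hd : d ≤ t) (c : Fin t → Fin n → ZMod 2)
    (hc : ∀ τ : Fin t, (τ : ℕ) < t - d → c τ = 0) : wt (tl hd c) = wt c := by
  rw [wt_eq, wt_eq, sum_tl hd]
  · rfl
  · intro i hi; simp [hc i hi]

theorem tl_mem {T nb n t d : ℕ} (h : Fin T → Matrix (Fin nb) (Fin n) (ZMod 2)) (ht : t ≤ T) (hd : d ≤ t)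
    (c) (hc : c ∈ CsetT nb n T (toep h) t ht d) : tl hd c ∈ Dset h d := by
  simp only [CsetT, Finset.mem_filter, Finset.mem_univ, true_and] at hc
  obtain ⟨h1, h2, h3⟩ := hc
  simp only [Dset, Finset.mem_filter, Finset.mem_univ, true_and]
  refine ⟨fun j hj => h3 _ (by simp [hj]), ?_⟩
  funext s a
  have h4 := congrFun h1 (⟨t - d + s, by omega⟩, a)
  simp only [Matrix.mulVec, dotProduct, Matrix.submatrix_apply, Fintype.sum_prod_type] at h4
  rw [sum_tl hd] at h4
  · rw [Pi.zero_apply] at h4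
    simp only [Pi.zero_apply]
    rw [← h4]
    unfold syn
    refine Finset.sum_congr rfl fun j _ => ?_
    by_cases hjs : (j : ℕ) ≤ s
    · have e : t - d + (s : ℕ) - (t - d + j) = s - j := by omega
      simp [toep, hjs, flat, tl, e]
    · simp [toep, hjs]
  · intro i hi
    simp [flat, h2 i hi]

theorem tl_inj {T nb n t d : ℕ} (H) (ht : t ≤ T) (hd : d ≤ t) :
    Set.InjOn (tl (n := n) hd) (CsetT nb n T H t ht d : Set (Fin t → Fin n → ZMod 2)) := by
  intro c hc c' hc' hcc
  simp only [CsetT, Finset.coe_filter, Finset.mem_univ, true_and, Set.mem_ofPred_eq] at hc hc'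
  funext i
  by_cases hi : (i : ℕ) < t - d
  · rw [hc.2.1 i hi, hc'.2.1 i hi]
  · have := congrFun hcc ⟨i - (t - d), by omega⟩
    simp only [tl] at this
    convert this using 2 <;> exact Fin.ext (by simp; omega)

theorem exists_h {T nb n d₀ : ℕ} (hT : 0 < T) (E0 : Matrix (Fin nb) (Fin n) (ZMod 2))
    (f : ∀ d, (Fin d → Fin n → ZMod 2) → ℝ) (hf : ∀ d c, 0 ≤ f d c)
    (hs : ∑ d ∈ Finset.Icc d₀ T, (1 / 2 ^ (nb * d) : ℝ) * ∑ c, f d c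
       < 1 / Fintype.card (Matrix (Fin nb) (Fin n) (ZMod 2))) :
    ∃ h : Fin T → Matrix (Fin nb) (Fin n) (ZMod 2), hx h 0 = E0 ∧
      ∀ d ∈ Finset.Icc d₀ T, ∑ c ∈ Dset h d, f d c < 1 := by
  by_contra hcon
  push Not at hcon
  set S := Finset.univ.filter fun h : Fin T → Matrix (Fin nb) (Fin n) (ZMod 2) => h ⟨0, hT⟩ = E0 with hS
  set X : (Fin T → Matrix (Fin nb) (Fin n) (ZMod 2)) → ℝ := fun h => ∑ d ∈ Finset.Icc d₀ T, ∑ c ∈ Dset h d, f d c with hX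
  have hD0 : ∀ h : Fin T → Matrix (Fin nb) (Fin n) (ZMod 2), ∀ d, 0 ≤ ∑ c ∈ Dset h d, f d c := fun h d => Finset.sum_nonneg fun c _ => hf d c
  have hX0 : ∀ h, 0 ≤ X h := fun h => Finset.sum_nonneg fun d _ => hD0 h d
  have hX1 : ∀ h ∈ S, 1 ≤ X h := by
    intro h hh
    simp only [hS, Finset.mem_filter, Finset.mem_univ, true_and] at hh
    obtain ⟨d, hd, h1⟩ := hcon h (by simp [hx, hT, hh])
    exact h1.trans (Finset.single_le_sum (fun d _ => hD0 h d) hd)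
  have hcard : (Fintype.card (Fin T → Matrix (Fin nb) (Fin n) (ZMod 2)) : ℝ)
      ≤ Fintype.card (Matrix (Fin nb) (Fin n) (ZMod 2)) * S.card := by
    have : Fintype.card (Fin T → Matrix (Fin nb) (Fin n) (ZMod 2)) ≤ ((Finset.univ : Finset (Matrix (Fin nb) (Fin n) (ZMod 2))) ×ˢ S).card := by
      rw [← Finset.card_univ]
      refine Finset.card_le_card_of_injOn (fun h => (h ⟨0, hT⟩, Function.update h ⟨0, hT⟩ E0)) ?_ ?_
      · intro h _; simp [hS]
      · intro h _ h' _ hh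
        simp only [Prod.mk.injEq] at hh
        funext i
        by_cases hi : i = ⟨0, hT⟩
        · rw [hi, hh.1]
        · simpa [hi] using congrFun hh.2 i
    rw [Finset.card_product, Finset.card_univ] at this
    exact_mod_cast this
  have h1 : (S.card : ℝ) ≤ ∑ h, X h := by
    calc (S.card : ℝ) = ∑ h ∈ S, 1 := by simp
      _ ≤ ∑ h ∈ S, X h := Finset.sum_le_sum hX1
      _ ≤ _ := Finset.sum_le_sum_of_subset_of_nonneg (Finset.subset_univ _) fun h _ _ => hX0 h
  have h2 : ∑ h, X h ≤ (Fintype.card (Fin T → Matrix (Fin nb) (Fin n) (ZMod 2)) : ℝ) *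
      ∑ d ∈ Finset.Icc d₀ T, (1 / 2 ^ (nb * d) : ℝ) * ∑ c, f d c := by
    rw [hX, Finset.sum_comm, Finset.mul_sum]
    refine Finset.sum_le_sum fun d hd => ?_
    rw [← mul_assoc]
    exact sum_D (Finset.mem_Icc.mp hd).2 (f d) (hf d)
  have hA : (0:ℝ) < Fintype.card (Fin T → Matrix (Fin nb) (Fin n) (ZMod 2)) := by
    exact_mod_cast Fintype.card_pos
  have hM : (0:ℝ) < Fintype.card (Matrix (Fin nb) (Fin n) (ZMod 2)) := by
    exact_mod_cast Fintype.card_pos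
  have h3 := mul_lt_mul_of_pos_left hs hA
  rw [mul_one_div, lt_div_iff₀ hM] at h3
  nlinarith

theorem tail_small (ρ : ℝ) (h0 : 0 ≤ ρ) (h1 : ρ < 1) (ε : ℝ) (hε : 0 < ε) :
    ∃ N : ℕ, ∀ d₀ ≥ N, ∀ T, ∑ d ∈ Finset.Icc d₀ T, ρ ^ d < ε := by
  have hlim := (tendsto_pow_atTop_nhds_zero_of_lt_one h0 h1).div_const (1 - ρ)
  rw [zero_div] at hlim
  obtain ⟨N, hN⟩ := Filter.eventually_atTop.mp (hlim.eventually (gt_mem_nhds hε))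
  refine ⟨N, fun d₀ hd T => lt_of_le_of_lt ?_ (hN d₀ hd)⟩
  have e : Finset.Icc d₀ T = Finset.Ico d₀ (T + 1) := by ext; simp
  rw [e]
  exact geom_sum_Ico_le_of_lt_one h0 h1

theorem rho1 (α R : ℝ) (hα0 : 0 < α) (hα2 : α < 1 / 2) (h : binH α < R) :
    (α / (1 - α)) ^ (-α) * (1 + α / (1 - α)) < (2:ℝ) ^ R := by
  have h1 : 0 < 1 - α := by linarith
  have e : (α / (1 - α)) ^ (-α) * (1 + α / (1 - α)) = (2:ℝ) ^ binH α := by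
    have e1 : 1 + α / (1 - α) = 1 / (1 - α) := by field_simp; ring
    rw [e1]
    apply Real.log_injOn_pos
    · simp only [Set.mem_Ioi]; positivity
    · simp only [Set.mem_Ioi]; positivity
    rw [Real.log_mul (by positivity) (by positivity), Real.log_rpow (by positivity),
      Real.log_rpow (by norm_num), Real.log_div hα0.ne' h1.ne', Real.log_div one_ne_zero h1.ne', Real.log_one]
    have : Real.log 2 ≠ 0 := by positivity
    unfold binH Real.logb
    field_simp
    ring
  rw [e]
  exact Real.rpow_lt_rpow_of_exponent_lt (by norm_num) h

theorem rho2 (θ R : ℝ) (hR : 0 < R) (h : Real.logb 2 (1 / (2 ^ R - 1)) < θ) :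
    1 + (2:ℝ) ^ (-θ) < 2 ^ R := by
  have h1 : (1:ℝ) < 2 ^ R := Real.one_lt_rpow (by norm_num) hR
  have h2 : 0 < (2:ℝ) ^ R - 1 := by linarith
  rw [one_div, Real.logb_inv] at h
  have h3 : -θ < Real.logb 2 (2 ^ R - 1) := by linarith
  rw [Real.lt_logb_iff_rpow_lt (by norm_num) h2] at h3
  linarith

end AnyT

open AnyT in
theorem finite_horizon_anytime_codes_exist
    (k n : ℕ) (hk : 0 < k) (hkn : k < n)
    (α θ : ℝ) (hα0 : 0 < α) (hα2 : α < 1 / 2)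
    (hαH : binH α < 1 - (k : ℝ) / n)
    (hθ : Real.logb 2 (1 / (2 ^ (1 - (k : ℝ) / n) - 1)) < θ) :
    ∃ d₀ : ℕ, ∀ T : ℕ, 0 < T →
      ∃ H : Matrix (Fin T × Fin (n - k)) (Fin T × Fin n) (ZMod 2),
        (∀ (i j : Fin T), (i : ℕ) < (j : ℕ) →
          ∀ (a : Fin (n - k)) (b : Fin n), H (i, a) (j, b) = 0) ∧
        LinearIndependent (ZMod 2) (fun r : Fin T × Fin (n - k) => H r) ∧
        (∀ (t : ℕ) (ht : t ≤ T) (d : ℕ), d₀ ≤ d → d ≤ t →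
          (∀ c ∈ CsetT (n - k) n T H t ht d, α * n * d ≤ (wt c : ℝ)) ∧
          (∀ w : ℕ, α * n * d ≤ (w : ℝ) →
            (((CsetT (n - k) n T H t ht d).filter fun c => wt c = w).card : ℝ)
              ≤ 2 ^ (θ * w))) := by
  have hn : (0:ℝ) < n := by exact_mod_cast (by omega : 0 < n)
  have hn0 : n ≠ 0 := by omega
  have hR : 0 < 1 - (k:ℝ) / n := by
    have : (k:ℝ) < n := by exact_mod_cast hkn
    rw [sub_pos, div_lt_one hn]; exact this
  have hpow : ((2:ℝ) ^ (1 - (k:ℝ) / n)) ^ n = 2 ^ (n - k) := by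
    rw [← Real.rpow_natCast, ← Real.rpow_mul (by norm_num), ← Real.rpow_natCast, Nat.cast_sub hkn.le]
    congr 1; field_simp
  have h1α : 0 < 1 - α := by linarith
  set l : ℝ := α / (1 - α) with hl
  have hl0 : 0 < l := by positivity
  have hl1 : l < 1 := by rw [hl, div_lt_one h1α]; linarith
  set x1 : ℝ := l ^ (-α) * (1 + l) with hx1
  set x2 : ℝ := 1 + (2:ℝ) ^ (-θ) with hx2
  have hx1p : 0 < x1 := by positivity
  have hx2p : 0 < x2 := by positivity
  have r1 : x1 < _ := rho1 α _ hα0 hα2 hαH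
  have r2 : x2 < _ := rho2 θ _ hR hθ
  have aux : ∀ x : ℝ, 0 < x → x < 2 ^ (1 - (k:ℝ) / n) → x ^ n / 2 ^ (n - k) < 1 := by
    intro x hx hlt
    rw [div_lt_one (by positivity), ← hpow]
    exact pow_lt_pow_left₀ hlt hx.le hn0
  set ε : ℝ := 1 / Fintype.card (Matrix (Fin (n - k)) (Fin n) (ZMod 2)) with hε
  have hεp : 0 < ε := by
    have hM : (0:ℝ) < Fintype.card (Matrix (Fin (n - k)) (Fin n) (ZMod 2)) := by
      exact_mod_cast Fintype.card_pos
    positivity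
  obtain ⟨N1, hN1⟩ := tail_small (x1 ^ n / 2 ^ (n - k)) (by positivity) (aux x1 hx1p r1) (ε / 2) (by linarith)
  obtain ⟨N2, hN2⟩ := tail_small (x2 ^ n / 2 ^ (n - k)) (by positivity) (aux x2 hx2p r2) (ε / 2) (by linarith)
  refine ⟨max N1 N2, fun T hT => ?_⟩
  let f : ∀ d, (Fin d → Fin n → ZMod 2) → ℝ := fun d c =>
    (l ^ (-α)) ^ (n * d) * l ^ wt c + ((2:ℝ) ^ (-θ)) ^ wt c
  have hf : ∀ d c, 0 ≤ f d c := fun d c => by positivity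
  obtain ⟨h, hh0, hh⟩ := exists_h (d₀ := max N1 N2) hT (E (n - k) n (Nat.sub_le _ _)) f hf (by
    have e : ∀ d, (1 / 2 ^ ((n - k) * d) : ℝ) * ∑ c, f d c
        = (x1 ^ n / 2 ^ (n - k)) ^ d + (x2 ^ n / 2 ^ (n - k)) ^ d := by
      intro d
      simp only [f]
      rw [Finset.sum_add_distrib, ← Finset.mul_sum, sum_wt, sum_wt, ← mul_pow, ← hx1, ← hx2]
      rw [div_pow, div_pow, ← pow_mul, ← pow_mul, ← pow_mul]
      ring
    simp_rw [e]
    rw [Finset.sum_add_distrib, ← hε]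
    have a1 := hN1 (max N1 N2) (le_max_left _ _) T
    have a2 := hN2 (max N1 N2) (le_max_right _ _) T
    linarith)
  refine ⟨toep h, ?_, toep_indep _ h hh0, ?_⟩
  · intro i j hij a b
    have : ¬ (j : ℕ) ≤ i := by omega
    simp only [toep, if_neg this]
  intro t ht d hd0 hdt
  have hlt := hh d (Finset.mem_Icc.mpr ⟨hd0, hdt.trans ht⟩)
  constructor
  · intro c hc
    by_contra hcon
    push Not at hcon
    have hm := tl_mem h ht hdt c hc
    have hw : wt (tl hdt c) = wt c := by
      simp only [CsetT, Finset.mem_filter, Finset.mem_univ, true_and] at hc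
      exact wt_tl hdt c hc.2.1
    have hle := Finset.single_le_sum (f := f d) (fun c _ => hf d c) hm
    have : 1 ≤ (l ^ (-α)) ^ (n * d) * l ^ wt c := by
      rw [← Real.rpow_natCast, ← Real.rpow_natCast, ← Real.rpow_mul hl0.le, ← Real.rpow_add hl0]
      apply Real.one_le_rpow_of_pos_of_le_one_of_nonpos hl0 hl1.le
      push_cast
      nlinarith
    have h5 : 0 < ((2:ℝ) ^ (-θ)) ^ wt c := by positivity
    simp only [f, hw] at hle
    simp only [f] at hlt
    linarith
  · intro w _
    have hcard : ((CsetT (n - k) n T (toep h) t ht d).filter fun c => wt c = w).card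
        ≤ ((Dset h d).filter fun c => wt c = w).card := by
      refine Finset.card_le_card_of_injOn (tl hdt) ?_ ?_
      · intro c hc
        simp only [Finset.coe_filter, Set.mem_ofPred_eq] at hc ⊢
        refine ⟨tl_mem h ht hdt c hc.1, ?_⟩
        rw [← hc.2]
        have hc1 := hc.1
        simp only [CsetT, Finset.mem_filter, Finset.mem_univ, true_and] at hc1
        exact wt_tl hdt c hc1.2.1
      · exact (tl_inj _ ht hdt).mono (by intro c hc; simp only [Finset.coe_filter, Set.mem_ofPred_eq] at hc; exact hc.1)
    have hcard' : (((CsetT (n - k) n T (toep h) t ht d).filter fun c => wt c = w).card : ℝ)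
        ≤ ((Dset h d).filter fun c => wt c = w).card := by exact_mod_cast hcard
    have h6 : (((Dset h d).filter fun c => wt c = w).card : ℝ) * ((2:ℝ) ^ (-θ)) ^ w ≤ ∑ c ∈ Dset h d, f d c := by
      calc _ = ∑ c ∈ (Dset h d).filter (fun c => wt c = w), ((2:ℝ) ^ (-θ)) ^ w := by simp
        _ ≤ ∑ c ∈ (Dset h d).filter (fun c => wt c = w), f d c := by
          refine Finset.sum_le_sum fun c hc => ?_
          rw [Finset.mem_filter] at hc
          simp only [f, hc.2]
          have : 0 ≤ (l ^ (-α)) ^ (n * d) * l ^ w := by positivity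
          linarith
        _ ≤ _ := Finset.sum_le_sum_of_subset_of_nonneg (Finset.filter_subset _ _) fun c _ _ => hf d c
    have h7 : ((2:ℝ) ^ (-θ)) ^ w = (2 ^ (θ * w))⁻¹ := by
      rw [← Real.rpow_natCast, ← Real.rpow_mul (by norm_num), ← Real.rpow_neg (by norm_num)]
      congr 1; ring
    have h8 : (0:ℝ) < 2 ^ (θ * w) := by positivity
    rw [h7, ← div_eq_mul_inv] at h6
    have h9 := h6.trans_lt hlt
    rw [div_lt_one h8] at h9
    linarith
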